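/- Adequacy of the thesis operator: for any formula A, if there exist a universal structure 𝒜 ∈ 𝔘𝔆, a valuation v on 𝒜, and a world w of 𝒜 such that 𝒜, v, w ⊨ □A, then A ∈ FOL□. -/

import Mathlib

namespace FOLBoxPaper

/-- Formulas of the language L(∀,□): atoms `P_j(x₁,…,xₙ)` (predicate index and
list of variables), identity `x = y`, negation, implication, universal
quantification, and the modal operator □. Variables are natural numbers. -/
inductive Formula : Type
  | atom : ℕ → List ℕ → Formula
  | eq : ℕ → ℕ → Formula
  | neg : Formula → Formula
  | imp : Formula → Formula → Formula
  | all : ℕ → Formula → Formula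
  | box : Formula → Formula

namespace Formula

/-- Conjunction, defined as usual. -/
def and (A B : Formula) : Formula := neg (imp A (neg B))

/-- Disjunction, defined as usual. -/
def or (A B : Formula) : Formula := imp (neg A) B

/-- Biconditional, defined as usual. -/
def iff (A B : Formula) : Formula := (imp A B).and (imp B A)

/-- ◇A := ¬□¬A. -/
def dia (A : Formula) : Formula := neg (box (neg A))

/-- ∃xA := ¬∀x¬A. -/
def ex (x : ℕ) (A : Formula) : Formula := neg (all x (neg A))

/-- A formula is □-free when it contains no occurrence of □. -/
def BoxFree : Formula → Prop
  | atom _ _ => True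
  | eq _ _ => True
  | neg A => BoxFree A
  | imp A B => BoxFree A ∧ BoxFree B
  | all _ A => BoxFree A
  | box _ => False

/-- `FreeIn x A`: the variable x has at least one ∀□-free occurrence in A,
i.e. an occurrence that is neither in the scope of a quantifier binding x
nor in the scope of □. -/
def FreeIn (x : ℕ) : Formula → Prop
  | atom _ args => x ∈ args
  | eq a b => x = a ∨ x = b
  | neg A => FreeIn x A
  | imp A B => FreeIn x A ∨ FreeIn x B
  | all z A => z ≠ x ∧ FreeIn x A
  | box _ => False

/-- The ∀□-free substitution `A(y/x)`: replace every ∀□-free occurrence of x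
in A by y (occurrences in the scope of □ or of a quantifier binding x are
left untouched). -/
def subst (A : Formula) (y x : ℕ) : Formula :=
  match A with
  | atom j args => atom j (args.map fun z => if z = x then y else z)
  | eq a b => eq (if a = x then y else a) (if b = x then y else b)
  | neg A => neg (subst A y x)
  | imp A B => imp (subst A y x) (subst B y x)
  | all z A => if z = x then all z A else all z (subst A y x)
  | box A => box A

/-- `Substitutable y x A`: the variable y is substitutable for the ∀□-free
occurrences of x in A, i.e. y is not captured by a quantifier when it
replaces x. -/
def Substitutable (y x : ℕ) : Formula → Prop
  | atom _ _ => True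
  | eq _ _ => True
  | neg A => Substitutable y x A
  | imp A B => Substitutable y x A ∧ Substitutable y x B
  | all z A => z = x ∨ ¬ FreeIn x A ∨ (z ≠ y ∧ Substitutable y x A)
  | box _ => True

end Formula

open Formula

/-- A first-order structure with variable domains:
a nonempty set of possible worlds, a nonempty domain of objects for each
world, and a world-relative interpretation of the predicate symbols. -/
structure Structure where
  W : Type
  wNonempty : Nonempty W
  D : W → Type
  dNonempty : ∀ w, Nonempty (D w)
  I : ℕ → (w : W) → List (D w) → Prop

/-- A valuation assigns, to each variable and world, an object of the domain
of that world. -/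
def Valuation (M : Structure) : Type := ℕ → (w : M.W) → M.D w

open Classical in
/-- The variant `v^a_x(w)` of a valuation v at world w: it maps x at w to a
and agrees with v everywhere else. -/
noncomputable def updateVal {M : Structure} (v : Valuation M) (x : ℕ)
    (w : M.W) (a : M.D w) : Valuation M :=
  fun y w' => if h : y = x ∧ w' = w then cast (congrArg M.D h.2.symm) a else v y w'

/-- Satisfaction `M, v, w ⊨ A`. The clause for □ quantifies over all
valuations and all worlds of the structure. -/
def Sat (M : Structure) : Valuation M → M.W → Formula → Prop
  | v, w, .atom j args => M.I j w (args.map fun z => v z w)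
  | v, w, .eq a b => v a w = v b w
  | v, w, .neg A => ¬ Sat M v w A
  | v, w, .imp A B => Sat M v w A → Sat M v w B
  | v, w, .all x A => ∀ a : M.D w, Sat M (updateVal v x w a) w A
  | _, _, .box A => ∀ (v' : Valuation M) (w' : M.W), Sat M v' w' A

/-- `M ⊨ A`: A is satisfied at every valuation and world of M. -/
def Models (M : Structure) (A : Formula) : Prop := ∀ v w, Sat M v w A

/-- Universal structures: M is universal when every □-free formula true
everywhere in M is true everywhere in every structure. -/
def Universal (M : Structure) : Prop :=
  ∀ B, BoxFree B → Models M B → ∀ N : Structure, Models N B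

/-- Logical validity: truth at every valuation and world of every universal
structure. -/
def Valid (A : Formula) : Prop :=
  ∀ M : Structure, Universal M → ∀ (v : Valuation M) (w : M.W), Sat M v w A

/-- FOL: the set of □-free classical first-order theses, i.e. □-free formulas
satisfied at every valuation and world of every structure. -/
def FOL : Set Formula := {A | BoxFree A ∧ ∀ M : Structure, Models M A}

/-- `PropTaut A`: A is an instantiation of a tautology of classical
propositional logic (it is true under every assignment of truth values to
formulas that respects ¬ and →). -/
def PropTaut (A : Formula) : Prop :=
  ∀ f : Formula → Prop,
    (∀ B, f (neg B) ↔ ¬ f B) → (∀ B C, f (imp B C) ↔ (f B → f C)) → f A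

/-- The system FOL□. -/
inductive FOLBox : Formula → Prop
  | taut {A} : PropTaut A → FOLBox A
  | axK {A B} : FOLBox ((box (A.imp B)).imp ((box A).imp (box B)))
  | axT {A} : FOLBox ((box A).imp A)
  | ax5 {A} : FOLBox ((neg (box A)).imp (box (neg (box A))))
  | axAll1 {A : Formula} {x y : ℕ} : Substitutable y x A →
      FOLBox ((all x A).imp (A.subst y x))
  | axAll2 {A B : Formula} {x : ℕ} : ¬ FreeIn x A →
      FOLBox ((all x (A.imp B)).imp (A.imp (all x B)))
  | axId {x : ℕ} : FOLBox (Formula.eq x x)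
  | axEq {A : Formula} {x y : ℕ} : BoxFree A → Substitutable y x A →
      FOLBox (((Formula.eq x y).and A).imp (A.subst y x))
  | axMix {A : Formula} {x : ℕ} : FOLBox ((box A).imp (all x A))
  | axBang {A} : BoxFree A → A ∉ FOL → FOLBox (neg (box A))
  | mp {A B} : FOLBox (A.imp B) → FOLBox A → FOLBox B
  | nec {A} : FOLBox A → FOLBox (box A)

/-- The conjunction of a (nonempty) finite list of formulas. -/
def conjList : List Formula → Formula
  | [] => Formula.eq 0 0
  | [A] => A
  | A :: B :: rest => A.and (conjList (B :: rest))

/-- FOL□-consistency: no finite conjunction of members of Γ has its negation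
in FOL□. -/
def Consistent (Γ : Set Formula) : Prop :=
  ∀ L : List Formula, L ≠ [] → (∀ B ∈ L, B ∈ Γ) → ¬ FOLBox (neg (conjList L))

/-- Maximal FOL□-consistency. -/
def MaxConsistent (Γ : Set Formula) : Prop :=
  Consistent Γ ∧ ∀ A, A ∈ Γ ∨ neg A ∈ Γ

/-- ∃-saturation: whenever ¬∀xA ∈ Γ there is a variable y with
¬A(y/x) ∈ Γ via a ∀□-free substitution. -/
def Saturated (Γ : Set Formula) : Prop :=
  ∀ (x : ℕ) (A : Formula), neg (all x A) ∈ Γ →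
    ∃ y : ℕ, Substitutable y x A ∧ neg (A.subst y x) ∈ Γ

/-- MC: the family of all ∃-saturated maximal FOL□-consistent sets. -/
def MC : Set (Set Formula) := {Γ | Saturated Γ ∧ MaxConsistent Γ}

/-- An elementary disjunction: a formula of the form
`A ∨ ◇B ∨ □C₁ ∨ … ∨ □Cₙ` with A, B, C₁, …, Cₙ □-free. -/
def ElemDisj (D : Formula) : Prop :=
  ∃ (A B : Formula) (Cs : List Formula),
    BoxFree A ∧ BoxFree B ∧ (∀ C ∈ Cs, BoxFree C) ∧
    D = (Cs.map Formula.box).foldl Formula.or (A.or B.dia)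

/-- A conjunctive form: a conjunction of elementary disjunctions. -/
def ConjForm (F : Formula) : Prop :=
  ∃ Ds : List Formula, Ds ≠ [] ∧ (∀ D ∈ Ds, ElemDisj D) ∧ F = conjList Ds

/-- The worlds of the canonical structure: members of MC. -/
def MCW : Type := {Γ : Set Formula // Γ ∈ MC}

/-- The relation ∼_Γ on variables: x ∼_Γ y iff the formula x = y belongs
to Γ. -/
def canonRel (Γ : MCW) (x y : ℕ) : Prop := Formula.eq x y ∈ Γ.val

/-- The canonical structure 𝒜^MC: worlds are the members of MC, the domain
of a world Γ consists of the classes [x]_{∼_Γ} of variables, and a predicate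
holds of such classes iff the corresponding atomic formula belongs to Γ. -/
noncomputable def canonicalStructure (h : Nonempty MCW) : Structure where
  W := MCW
  wNonempty := h
  D := fun Γ => Quot (canonRel Γ)
  dNonempty := fun Γ => ⟨Quot.mk _ 0⟩
  I := fun j Γ ds =>
    ∃ xs : List ℕ, ds = xs.map (Quot.mk (canonRel Γ)) ∧ Formula.atom j xs ∈ Γ.val

/-- The canonical valuation v^MC: v^MC(x, Γ) = [x]_{∼_Γ}. -/
noncomputable def canonicalVal (h : Nonempty MCW) : Valuation (canonicalStructure h) :=
  fun x Γ => Quot.mk (canonRel Γ) x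

namespace Formula

/-- An injective numbering of formulas. -/
def code : Formula → ℕ
  | atom j l => Nat.pair 0 (Nat.pair j (Encodable.encode l))
  | eq a b => Nat.pair 1 (Nat.pair a b)
  | neg A => Nat.pair 2 A.code
  | imp A B => Nat.pair 3 (Nat.pair A.code B.code)
  | all x A => Nat.pair 4 (Nat.pair x A.code)
  | box A => Nat.pair 5 A.code

theorem code_injective : Function.Injective code := by
  intro A
  induction A with
  | atom j l => intro B h; cases B <;> simp_all [code, Nat.pair_eq_pair]
  | eq a b => intro B h; cases B <;> simp_all [code, Nat.pair_eq_pair]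
  | neg A ih =>
    intro B h
    cases B <;> simp [code, Nat.pair_eq_pair] at h
    rw [ih h]
  | imp A A' ih ih' =>
    intro B h
    cases B <;> simp [code, Nat.pair_eq_pair] at h
    rw [ih h.1, ih' h.2]
  | all x A ih =>
    intro B h
    cases B <;> simp [code, Nat.pair_eq_pair] at h
    rw [h.1, ih h.2]
  | box A ih =>
    intro B h
    cases B <;> simp [code, Nat.pair_eq_pair] at h
    rw [ih h]

instance : Countable Formula := code_injective.countable

instance : Nonempty Formula := ⟨eq 0 0⟩

/-- `Fresh y A`: the variable y does not occur in A outside the scope of □,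
neither free nor bound. -/
def Fresh (y : ℕ) : Formula → Prop
  | atom _ args => y ∉ args
  | eq a b => y ≠ a ∧ y ≠ b
  | neg A => Fresh y A
  | imp A B => Fresh y A ∧ Fresh y B
  | all z A => z ≠ y ∧ Fresh y A
  | box _ => True

theorem exists_fresh_bound (A : Formula) : ∃ N, ∀ y, N ≤ y → Fresh y A := by
  induction A with
  | atom j l =>
    refine ⟨l.sum + 1, fun y hy hm => ?_⟩
    have := List.le_sum_of_mem hm
    omega
  | eq a b => exact ⟨a + b + 1, fun y hy => ⟨by omega, by omega⟩⟩
  | neg A ih => exact ih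
  | imp A B ihA ihB =>
    obtain ⟨m, hm⟩ := ihA
    obtain ⟨n, hn⟩ := ihB
    exact ⟨m + n, fun y hy => ⟨hm y (by omega), hn y (by omega)⟩⟩
  | all z A ih =>
    obtain ⟨m, hm⟩ := ih
    exact ⟨m + z + 1, fun y hy => ⟨by omega, hm y (by omega)⟩⟩
  | box A => exact ⟨0, fun _ _ => trivial⟩

theorem Fresh.not_freeIn {y : ℕ} {A : Formula} (h : Fresh y A) : ¬ FreeIn y A := by
  induction A <;> simp_all [Fresh, FreeIn]

theorem Fresh.substitutable {x y : ℕ} {A : Formula} (h : Fresh y A) : Substitutable y x A := by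
  induction A <;> simp_all [Fresh, Substitutable]

theorem substitutable_self (x : ℕ) (A : Formula) : Substitutable x x A := by
  induction A <;> simp_all [Substitutable]
  tauto

theorem subst_self (x : ℕ) (A : Formula) : A.subst x x = A := by
  have hif : ∀ z, (if z = x then x else z) = z := fun z => by
    by_cases hz : z = x <;> simp [hz]
  induction A with
  | atom j l => simp only [subst, hif, List.map_id']
  | eq a b => simp only [subst, hif]
  | _ => simp_all [subst]

theorem subst_eq_self {x y : ℕ} {A : Formula} (h : ¬ FreeIn x A) : A.subst y x = A := by
  induction A with
  | atom j l =>
    simp only [FreeIn] at h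
    simp only [subst, atom.injEq, true_and]
    conv_rhs => rw [← List.map_id l]
    exact List.map_congr_left fun z hz => if_neg (by rintro rfl; exact h hz)
  | eq a b => simp_all [FreeIn, subst, eq_comm]
  | neg A ih => simp_all [FreeIn, subst]
  | imp A B ihA ihB => simp_all [FreeIn, subst]
  | all z A ih =>
    by_cases hz : z = x <;> simp_all [FreeIn, subst]
  | box A => rfl

theorem Fresh.subst_subst {x y : ℕ} {A : Formula} (h : Fresh y A) :
    (A.subst y x).subst x y = A := by
  induction A with
  | atom j l =>
    simp only [Fresh] at h
    simp only [subst, List.map_map, atom.injEq, true_and]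
    conv_rhs => rw [← List.map_id l]
    refine List.map_congr_left fun z hz => ?_
    have : z ≠ y := by rintro rfl; exact h hz
    by_cases hx : z = x <;> simp [hx, this]
  | eq a b =>
    obtain ⟨h1, h2⟩ := h
    simp only [subst, eq.injEq]
    grind
  | neg A ih => simp_all [Fresh, subst]
  | imp A B ihA ihB => simp_all [Fresh, subst]
  | all z A ih =>
    obtain ⟨hz, hA⟩ := h
    by_cases hx : z = x
    · simp only [subst, if_pos hx, if_neg hz, subst_eq_self hA.not_freeIn]
    · simp [subst, hx, hz, ih hA]
  | box A => rfl

theorem Fresh.substitutable_subst {x y : ℕ} {A : Formula} (h : Fresh y A) :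
    Substitutable x y (A.subst y x) := by
  induction A with
  | all z A ih =>
    obtain ⟨hz, hA⟩ := h
    by_cases hx : z = x
    · simp only [subst, if_pos hx]
      exact Or.inr (Or.inl hA.not_freeIn)
    · simp only [subst, if_neg hx]
      exact Or.inr (Or.inr ⟨hx, ih hA⟩)
  | _ => simp_all [Fresh, subst, Substitutable]

theorem not_freeIn_subst {x y : ℕ} (hxy : x ≠ y) (A : Formula) : ¬ FreeIn x (A.subst y x) := by
  induction A with
  | atom j l => simp only [subst, FreeIn, List.mem_map]; grind
  | eq a b => simp only [subst, FreeIn]; grind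
  | all z A ih => by_cases hz : z = x <;> simp_all [subst, FreeIn]
  | _ => simp_all [subst, FreeIn]

theorem BoxFree.subst {A : Formula} (h : BoxFree A) (y x : ℕ) : BoxFree (A.subst y x) := by
  induction A with
  | all z A ih => by_cases hz : z = x <;> simp_all [Formula.subst, BoxFree]
  | _ => simp_all [Formula.subst, BoxFree]

/-- The number of connectives and operators in a formula. -/
def size : Formula → ℕ
  | atom _ _ => 0
  | eq _ _ => 0
  | neg A => A.size + 1
  | imp A B => A.size + B.size + 1
  | all _ A => A.size + 1
  | box A => A.size + 1

theorem size_subst (A : Formula) (y x : ℕ) : (A.subst y x).size = A.size := by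
  induction A with
  | all z A ih => by_cases hz : z = x <;> simp_all [subst, size]
  | _ => simp_all [subst, size]

end Formula

section Semantics

variable {M : Structure}

theorem updateVal_apply (v : Valuation M) (x : ℕ) (w : M.W) (a : M.D w) (y : ℕ) :
    updateVal v x w a y w = if y = x then a else v y w := by
  by_cases h : y = x <;> simp [updateVal, h]

theorem sat_congr {v v' : Valuation M} {w : M.W} (h : ∀ y, v y w = v' y w) (A : Formula) :
    Sat M v w A ↔ Sat M v' w A := by
  induction A generalizing v v' with
  | atom j l => simp only [Sat, h]
  | eq a b => simp only [Sat, h]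
  | neg A ih => simp only [Sat, ih h]
  | imp A B ihA ihB => simp only [Sat, ihA h, ihB h]
  | all x A ih =>
    simp only [Sat]
    exact forall_congr' fun a => ih fun y => by simp only [updateVal_apply, h]
  | box A => simp only [Sat]

theorem sat_subst {x y : ℕ} {A : Formula} (hy : Fresh y A) (v : Valuation M) (w : M.W) :
    Sat M v w (A.subst y x) ↔ Sat M (updateVal v x w (v y w)) w A := by
  induction A generalizing v with
  | atom j l =>
    simp only [subst, Sat, List.map_map, updateVal_apply]
    have : ((fun z => v z w) ∘ fun z => if z = x then y else z) =
        fun z => if z = x then v y w else v z w := by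
      funext z
      by_cases hz : z = x <;> simp [hz]
    rw [this]
  | eq a b =>
    simp only [subst, Sat, updateVal_apply]
    by_cases ha : a = x <;> by_cases hb : b = x <;> simp [ha, hb]
  | neg A ih => simp only [subst, Sat, ih hy]
  | imp A B ihA ihB => simp only [subst, Sat, ihA hy.1, ihB hy.2]
  | all z A ih =>
    by_cases hz : z = x
    · simp only [subst, if_pos hz, Sat]
      refine forall_congr' fun a => sat_congr (fun u => ?_) A
      simp only [updateVal_apply]
      grind
    · simp only [subst, if_neg hz, Sat]
      refine forall_congr' fun a => (ih hy.2 _).trans (sat_congr (fun u => ?_) A)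
      have := hy.1
      simp only [updateVal_apply]
      grind
  | box A => simp only [subst, Sat]

end Semantics

namespace FOLBox

theorem gen {A : Formula} (x : ℕ) (h : FOLBox A) : FOLBox (all x A) := mp axMix (nec h)

theorem inst {A : Formula} {x y : ℕ} (hs : Substitutable y x A) (h : FOLBox A) :
    FOLBox (A.subst y x) := mp (axAll1 hs) (gen x h)

theorem imp_trans {A B C : Formula} (h₁ : FOLBox (A.imp B)) (h₂ : FOLBox (B.imp C)) :
    FOLBox (A.imp C) := by
  refine mp (mp (taut (A := (A.imp B).imp ((B.imp C).imp (A.imp C))) ?_) h₁) h₂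
  intro f hn hi; simp only [hi]; tauto

theorem imp_self (A : Formula) : FOLBox (A.imp A) :=
  taut fun f hn hi => by simp only [hi]; tauto

theorem weaken {A : Formula} (C : Formula) (h : FOLBox A) : FOLBox (C.imp A) :=
  mp (taut fun f hn hi => by simp only [hi]; tauto) h

theorem imp_mp {A B C : Formula} (h₁ : FOLBox (C.imp (A.imp B))) (h₂ : FOLBox (C.imp A)) :
    FOLBox (C.imp B) :=
  mp (mp (taut (A := (C.imp (A.imp B)).imp ((C.imp A).imp (C.imp B)))
    fun f hn hi => by simp only [hi]; tauto) h₁) h₂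

theorem curry {A B C : Formula} (h : FOLBox ((A.and B).imp C)) : FOLBox (A.imp (B.imp C)) :=
  mp (taut fun f hn hi => by simp only [Formula.and, hi, hn]; tauto) h

theorem neg_imp_neg {A B : Formula} (h : FOLBox (A.imp B)) :
    FOLBox ((neg B).imp (neg A)) :=
  mp (taut fun f hn hi => by simp only [hi, hn]; tauto) h

theorem imp_congr {A A' B B' : Formula} (hA : FOLBox (A'.imp A)) (hB : FOLBox (B.imp B')) :
    FOLBox ((A.imp B).imp (A'.imp B')) :=
  mp (mp (taut (A := (A'.imp A).imp ((B.imp B').imp ((A.imp B).imp (A'.imp B'))))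
    fun f hn hi => by simp only [hi]; tauto) hA) hB

theorem imp_all {A B : Formula} {x : ℕ} (hx : ¬ FreeIn x A) (h : FOLBox (A.imp B)) :
    FOLBox (A.imp (all x B)) := mp (axAll2 hx) (gen x h)

theorem all_imp_self (x : ℕ) (A : Formula) : FOLBox ((all x A).imp A) := by
  simpa only [subst_self] using axAll1 (substitutable_self x A)

theorem all_congr {A B : Formula} (x : ℕ) (h : FOLBox (A.imp B)) :
    FOLBox ((all x A).imp (all x B)) :=
  imp_all (by simp [FreeIn]) (imp_trans (all_imp_self x A) h)

theorem all_subst_imp {A : Formula} {x y : ℕ} (hxy : x ≠ y) (hy : Fresh y A) :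
    FOLBox ((all y (A.subst y x)).imp (all x A)) := by
  have h := axAll1 hy.substitutable_subst (x := y) (y := x)
  rw [hy.subst_subst] at h
  exact imp_all (fun hf => not_freeIn_subst hxy A hf.2) h

theorem eq_left (x y z : ℕ) :
    FOLBox ((Formula.eq x y).imp ((Formula.eq x z).imp (Formula.eq y z))) := by
  have h := curry (axEq (A := Formula.eq (x + y + z + 1) z) (x := x + y + z + 1) (y := y)
    trivial trivial)
  have h' := inst (x := x + y + z + 1) (y := x) (by simp [subst, Substitutable]) h
  have hy : y ≠ x + y + z + 1 := by omega
  have hz : z ≠ x + y + z + 1 := by omega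
  simpa [subst, hy, hz] using h'

theorem atom_congr (j x y : ℕ) (l r : List ℕ) :
    FOLBox ((Formula.eq x y).imp ((atom j (l ++ x :: r)).imp (atom j (l ++ y :: r)))) := by
  obtain ⟨N, hN⟩ := exists_fresh_bound (atom j (y :: (l ++ r)))
  have hf := hN N le_rfl
  simp only [Fresh, List.mem_cons, List.mem_append, not_or] at hf
  obtain ⟨hy, hl, hr⟩ := hf
  have key : ∀ (u : ℕ) (s : List ℕ), N ∉ s → (s.map fun z => if z = N then u else z) = s := by
    intro u s hs
    have := subst_eq_self (A := atom 0 s) (x := N) (y := u) hs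
    simpa only [subst, atom.injEq, true_and] using this
  have h := curry (axEq (A := atom j (l ++ N :: r)) (x := N) (y := y) trivial trivial)
  have h' := inst (x := N) (y := x) (by simp [subst, Substitutable]) h
  simpa only [subst, List.map_append, List.map_cons, key _ _ hl, key _ _ hr, if_true,
    if_neg (Ne.symm hy)] using h'

theorem ex_eq {y z : ℕ} (h : y ≠ z) : FOLBox (neg (all z (neg (Formula.eq z y)))) := by
  have h₁ := axAll1 (A := neg (Formula.eq z y)) (x := z) (y := y) trivial
  simp only [subst, if_true, if_neg h] at h₁
  exact mp (mp (taut (A := ((all z (neg (Formula.eq z y))).imp (neg (Formula.eq y y))).imp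
    ((Formula.eq y y).imp (neg (all z (neg (Formula.eq z y))))))
    fun f hn hi => by simp only [hi, hn]; tauto) h₁) axId

end FOLBox

section Completeness

open FOLBox

/-- `Decides C φ N D`: D is a consistent strengthening of C that decides φ and, when it
refutes a universal formula φ, provides a counterinstance with a fresh variable `≥ N`. -/
def Decides (C φ : Formula) (N : ℕ) (D : Formula) : Prop :=
  ¬ FOLBox (neg D) ∧ FOLBox (D.imp C) ∧
    (FOLBox (D.imp φ) ∨ FOLBox (D.imp (neg φ)) ∧
      ∀ x A, φ = all x A → ∃ y, N ≤ y ∧ Fresh y A ∧ FOLBox (D.imp (neg (A.subst y x))))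

theorem exists_decides {C : Formula} (hC : ¬ FOLBox (neg C)) (φ : Formula) (N : ℕ) :
    ∃ D, Decides C φ N D := by
  by_cases h : FOLBox (neg (C.and (neg φ)))
  · refine ⟨C, hC, imp_self C, Or.inl (mp (taut ?_) h)⟩
    intro f hn hi; simp only [Formula.and, hi, hn]; tauto
  have hl : FOLBox ((C.and (neg φ)).imp C) :=
    taut fun f hn hi => by simp only [Formula.and, hi, hn]; tauto
  have hr : FOLBox ((C.and (neg φ)).imp (neg φ)) :=
    taut fun f hn hi => by simp only [Formula.and, hi, hn]; tauto
  by_cases hφ : ∃ x A, φ = all x A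
  · obtain ⟨x, A, rfl⟩ := hφ
    set E := C.and (neg (all x A))
    obtain ⟨K, hK⟩ := exists_fresh_bound (E.imp A)
    have hy := hK (K + N + x + 1) (by omega)
    set y := K + N + x + 1 with hydef
    have hl' : FOLBox ((E.and (neg (A.subst y x))).imp E) :=
      taut fun f hn hi => by simp only [Formula.and, hi, hn]; tauto
    refine ⟨E.and (neg (A.subst y x)), fun hbad => h ?_, imp_trans hl' hl,
      Or.inr ⟨imp_trans hl' hr, ?_⟩⟩
    · have h₁ : FOLBox (E.imp (A.subst y x)) :=
        mp (taut fun f hn hi => by simp only [Formula.and, hi, hn]; tauto) hbad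
      have h₂ := imp_trans (imp_all hy.1.not_freeIn h₁)
        (all_subst_imp (x := x) (by omega) hy.2)
      refine mp (mp (taut (A := (E.imp (all x A)).imp
        ((E.imp (neg (all x A))).imp (neg E))) ?_) h₂) hr
      intro f hn hi; simp only [hi, hn]; tauto
    · rintro x' A' ⟨⟩
      exact ⟨y, by omega, hy.2, taut fun f hn hi => by
        simp only [Formula.and, hi, hn]; tauto⟩
  · exact ⟨_, h, hl, Or.inr ⟨hr, fun x A hA => (hφ ⟨x, A, hA⟩).elim⟩⟩

/-- A complete consistent theory closed under derivability, in which every refuted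
universal formula has counterinstances with arbitrarily large fresh variables. -/
structure IsHenkin (Γ : Set Formula) : Prop where
  thm : ∀ {A}, FOLBox A → A ∈ Γ
  mp : ∀ {A B}, A.imp B ∈ Γ → A ∈ Γ → B ∈ Γ
  neg_iff : ∀ A, neg A ∈ Γ ↔ A ∉ Γ
  witness : ∀ {x A}, neg (all x A) ∈ Γ → ∀ N, ∃ y, N ≤ y ∧ Fresh y A ∧ neg (A.subst y x) ∈ Γ

theorem exists_isHenkin {C : Formula} (hC : ¬ FOLBox (neg C)) : ∃ Γ, C ∈ Γ ∧ IsHenkin Γ := by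
  obtain ⟨e, he⟩ := exists_surjective_nat (Formula × ℕ)
  choose next hnext using fun (c : {C : Formula // ¬ FOLBox (neg C)}) (n : ℕ) =>
    exists_decides c.2 (e n).1 (e n).2
  let s : ℕ → {C : Formula // ¬ FOLBox (neg C)} := fun n =>
    Nat.rec ⟨C, hC⟩ (fun n c => ⟨next c n, (hnext c n).1⟩) n
  have hs : ∀ n, Decides (s n).1 (e n).1 (e n).2 (s (n + 1)).1 := fun n => hnext (s n) n
  have hmono : ∀ m k, FOLBox ((s (m + k)).1.imp (s m).1) := by
    intro m k
    induction k with
    | zero => exact imp_self _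
    | succ k ih => exact imp_trans (hs (m + k)).2.1 ih
  have hle : ∀ {m n A}, m ≤ n → FOLBox ((s m).1.imp A) → FOLBox ((s n).1.imp A) := by
    intro m n A hmn h
    obtain ⟨k, rfl⟩ := Nat.exists_eq_add_of_le hmn
    exact imp_trans (hmono m k) h
  have hcons : ∀ {m n A}, FOLBox ((s m).1.imp A) → ¬ FOLBox ((s n).1.imp (neg A)) := by
    intro m n A h₁ h₂
    have h₁' := hle (le_max_left m n) h₁
    have h₂' := hle (le_max_right m n) h₂
    refine (s (max m n)).2 (FOLBox.mp (FOLBox.mp (taut (A := ((s (max m n)).1.imp A).imp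
      (((s (max m n)).1.imp (neg A)).imp (neg (s (max m n)).1))) ?_) h₁') h₂')
    intro f hn hi; simp only [hi, hn]; tauto
  refine ⟨{A | ∃ n, FOLBox ((s n).1.imp A)}, ⟨0, imp_self C⟩, ?_, ?_, ?_, ?_⟩
  · exact fun h => ⟨0, weaken _ h⟩
  · rintro A B ⟨m, hm⟩ ⟨n, hn⟩
    exact ⟨max m n, imp_mp (hle (le_max_left m n) hm) (hle (le_max_right m n) hn)⟩
  · intro A
    constructor
    · rintro ⟨m, hm⟩ ⟨n, hn⟩
      exact hcons hn hm
    · intro h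
      obtain ⟨n, hn⟩ := he (A, 0)
      have hd := (hs n).2.2
      rw [hn] at hd
      exact hd.elim (fun h' => (h ⟨n + 1, h'⟩).elim) fun h' => ⟨n + 1, h'.1⟩
  · rintro x A ⟨m, hm⟩ N
    obtain ⟨n, hn⟩ := he (all x A, N)
    have hd := (hs n).2.2
    rw [hn] at hd
    rcases hd with hd | ⟨-, hd⟩
    · exact (hcons (n := m) (m := n + 1) hd hm).elim
    · obtain ⟨y, hy, hf, h⟩ := hd x A rfl
      exact ⟨y, hy, hf, n + 1, h⟩

namespace IsHenkin

variable {Γ : Set Formula}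

theorem imp_iff (hΓ : IsHenkin Γ) (A B : Formula) : A.imp B ∈ Γ ↔ (A ∈ Γ → B ∈ Γ) := by
  refine ⟨hΓ.mp, fun h => ?_⟩
  by_cases hA : A ∈ Γ
  · exact hΓ.mp (hΓ.thm (taut fun f hn hi => by simp only [hi]; tauto)) (h hA)
  · exact hΓ.mp (hΓ.thm (taut fun f hn hi => by simp only [hi, hn]; tauto)) ((hΓ.neg_iff A).2 hA)

/-- Provable identity in a Henkin theory is an equivalence relation on variables. -/
def setoid (hΓ : IsHenkin Γ) : Setoid ℕ where
  r x y := Formula.eq x y ∈ Γ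
  iseqv := by
    have hsymm : ∀ {x y}, Formula.eq x y ∈ Γ → Formula.eq y x ∈ Γ := fun {x y} h =>
      hΓ.mp (hΓ.mp (hΓ.thm (eq_left x y x)) h) (hΓ.thm axId)
    exact ⟨fun x => hΓ.thm axId, hsymm, fun {x y z} hxy hyz =>
      hΓ.mp (hΓ.mp (hΓ.thm (eq_left y x z)) (hsymm hxy)) hyz⟩

/-- The one-world structure of classes of variables determined by a Henkin theory. -/
def termStructure (hΓ : IsHenkin Γ) : Structure where
  W := Unit
  wNonempty := ⟨()⟩
  D := fun _ => Quotient hΓ.setoid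
  dNonempty := fun _ => ⟨Quotient.mk _ 0⟩
  I := fun j _ ds => ∃ xs : List ℕ, ds = xs.map (Quotient.mk hΓ.setoid) ∧ atom j xs ∈ Γ

/-- The valuation sending each variable to its class. -/
def termVal (hΓ : IsHenkin Γ) : Valuation hΓ.termStructure := fun x _ => Quotient.mk hΓ.setoid x

theorem atom_mem_of_map_eq (hΓ : IsHenkin Γ) (j : ℕ) {xs ys : List ℕ}
    (h : xs.map (Quotient.mk hΓ.setoid) = ys.map (Quotient.mk hΓ.setoid)) (l : List ℕ)
    (hx : atom j (l ++ xs) ∈ Γ) : atom j (l ++ ys) ∈ Γ := by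
  induction xs generalizing ys l with
  | nil =>
    cases ys with
    | nil => exact hx
    | cons y ys => simp at h
  | cons x xs ih =>
    cases ys with
    | nil => simp at h
    | cons y ys =>
      simp only [List.map_cons, List.cons.injEq] at h
      have hxy : Formula.eq x y ∈ Γ := Quotient.exact h.1
      have h₁ := hΓ.mp (hΓ.mp (hΓ.thm (atom_congr j x y l xs)) hxy) hx
      simpa using ih h.2 (l ++ [y]) (by simpa using h₁)

theorem exists_fresh_eq (hΓ : IsHenkin Γ) (y N : ℕ) : ∃ z, N ≤ z ∧ Formula.eq z y ∈ Γ := by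
  have h : y ≠ y + 1 := by omega
  obtain ⟨z, hz, -, hw⟩ := hΓ.witness (hΓ.thm (ex_eq h)) N
  simp only [subst, if_true, if_neg h, hΓ.neg_iff, not_not] at hw
  exact ⟨z, hz, hw⟩

theorem sat_iff (hΓ : IsHenkin Γ) (n : ℕ) (A : Formula) (hn : A.size ≤ n) (hA : BoxFree A) :
    Sat hΓ.termStructure hΓ.termVal () A ↔ A ∈ Γ := by
  induction n generalizing A with
  | zero | succ n ih =>
    cases A with
    | atom j l =>
      simp only [Sat]
      constructor
      · rintro ⟨xs, hxs, hm⟩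
        exact hΓ.atom_mem_of_map_eq j hxs.symm [] hm
      · exact fun h => ⟨l, rfl, h⟩
    | eq a b => exact ⟨fun h => Quotient.exact h, fun h => Quotient.sound h⟩
    | neg A =>
      first
      | simp [size] at hn; done
      | rw [hΓ.neg_iff]
        exact not_congr (ih A (by simp only [size] at hn; omega) hA)
    | imp A B =>
      first
      | simp [size] at hn; done
      | rw [hΓ.imp_iff]
        simp only [size] at hn
        exact _root_.imp_congr (ih A (by omega) hA.1) (ih B (by omega) hA.2)
    | all x A =>
      first
      | simp [size] at hn; done
      | have ihs : ∀ y, Sat hΓ.termStructure hΓ.termVal () (A.subst y x) ↔ A.subst y x ∈ Γ :=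
          fun y => ih _ (by rw [size_subst]; simp only [size] at hn; omega)
            (BoxFree.subst (A := A) hA y x)
        simp only [Sat]
        constructor
        · intro h
          by_contra hm
          obtain ⟨y, -, hf, hy⟩ := hΓ.witness ((hΓ.neg_iff _).2 hm) 0
          exact (hΓ.neg_iff _).1 hy ((ihs y).1 ((sat_subst hf _ _).2 (h _)))
        · intro h a
          obtain ⟨y, rfl⟩ := Quotient.exists_rep a
          obtain ⟨N, hN⟩ := exists_fresh_bound A
          obtain ⟨z, hz, hzy⟩ := hΓ.exists_fresh_eq y N
          have hs := (ihs z).2 (hΓ.mp (hΓ.thm (axAll1 (hN z hz).substitutable)) h)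
          replace hs := (sat_subst (hN z hz) _ _).1 hs
          have hzy' : hΓ.termVal z () = Quotient.mk hΓ.setoid y := Quotient.sound hzy
          rwa [hzy'] at hs
    | box A => exact hA.elim

end IsHenkin

/-- Completeness for classical first-order logic: every first-order thesis is derivable. -/
theorem folBox_of_mem_FOL {A : Formula} (hA : A ∈ FOL) : FOLBox A := by
  by_contra h
  have hC : ¬ FOLBox (neg (neg A)) := fun h' =>
    h (FOLBox.mp (taut fun f hn hi => by simp only [hi, hn]; tauto) h')
  obtain ⟨Γ, hmem, hΓ⟩ := exists_isHenkin hC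
  exact (hΓ.neg_iff A).1 hmem ((hΓ.sat_iff _ A le_rfl hA.1).1 (hA.2 _ _ _))

end Completeness

open FOLBox in
/-- Every formula is equivalent, both provably and in all universal structures, to a
□-free formula. -/
theorem exists_boxFree_equiv (A : Formula) :
    ∃ B, BoxFree B ∧ FOLBox (A.imp B) ∧ FOLBox (B.imp A) ∧
      ∀ M : Structure, Universal M → ∀ (v : Valuation M) (w : M.W), Sat M v w A ↔ Sat M v w B := by
  induction A with
  | atom j l => exact ⟨atom j l, trivial, imp_self _, imp_self _, fun _ _ _ _ => Iff.rfl⟩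
  | eq a b => exact ⟨Formula.eq a b, trivial, imp_self _, imp_self _, fun _ _ _ _ => Iff.rfl⟩
  | neg A ih =>
    obtain ⟨B, hB, h₁, h₂, hM⟩ := ih
    exact ⟨neg B, hB, neg_imp_neg h₂, neg_imp_neg h₁, fun M hU v w => not_congr (hM M hU v w)⟩
  | imp A A' ih ih' =>
    obtain ⟨B, hB, h₁, h₂, hM⟩ := ih
    obtain ⟨B', hB', h₁', h₂', hM'⟩ := ih'
    exact ⟨B.imp B', ⟨hB, hB'⟩, imp_congr h₂ h₁', imp_congr h₁ h₂',
      fun M hU v w => _root_.imp_congr (hM M hU v w) (hM' M hU v w)⟩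
  | all x A ih =>
    obtain ⟨B, hB, h₁, h₂, hM⟩ := ih
    exact ⟨all x B, hB, all_congr x h₁, all_congr x h₂,
      fun M hU v w => forall_congr' fun a => hM M hU _ w⟩
  | box A ih =>
    obtain ⟨B, hB, h₁, h₂, hM⟩ := ih
    by_cases hF : B ∈ FOL
    · refine ⟨Formula.eq 0 0, trivial, weaken _ axId,
        weaken _ (nec (mp h₂ (folBox_of_mem_FOL hF))), fun M hU v w => ?_⟩
      exact iff_of_true (fun v' w' => (hM M hU v' w').2 (hF.2 M v' w')) rfl
    · have hbox : FOLBox (neg (box A)) :=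
        mp (neg_imp_neg (mp axK (nec h₁))) (axBang hB hF)
      refine ⟨neg (Formula.eq 0 0), trivial,
        mp (taut fun f hn hi => by simp only [hi, hn]; tauto) hbox,
        mp (taut fun f hn hi => by simp only [hi, hn]; tauto) (axId (x := 0)),
        fun M hU v w => ?_⟩
      refine iff_of_false (fun h => hF ⟨hB, ?_⟩) fun h => h rfl
      exact hU B hB fun v₁ w₁ => (hM M hU v₁ w₁).1 (h v₁ w₁)

/-- Adequacy of the thesis operator: if □A is satisfied at
some valuation and world of some universal structure, then A ∈ FOL□. -/
theorem box_adequacy (A : Formula)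
    (h : ∃ (M : Structure) (_ : Universal M) (v : Valuation M) (w : M.W),
      Sat M v w (Formula.box A)) :
    FOLBox A := by
  obtain ⟨M, hU, v, w, hA⟩ := h
  obtain ⟨B, hB, -, hBA, hM⟩ := exists_boxFree_equiv A
  exact .mp hBA (folBox_of_mem_FOL ⟨hB, hU B hB fun v' w' => (hM M hU v' w').1 (hA v' w')⟩)

end FOLBoxPaper
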